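/- Let g ≥ 2 and λ ≥ 1 be integers and set v = g(gλ+2), k = gλ+1, m = gλ+2, n = g, λ₁ = 0, λ₂ = λ. Then for no integer f ≥ 3 and no non-negative integers σ,τ,ρ does there exist a linked system of SGDDs of type II with parameters (v,k,m,n,λ₁,λ₂) and (σ,τ,ρ). -/

import Mathlib

open Matrix

/-- The all-ones matrix. -/
def matJ (α : Type*) : Matrix α α ℝ := Matrix.of fun _ _ => 1

/-- The block-diagonal matrix `K_{m,n} = I_m ⊗ J_n`. -/
def matK (m n : ℕ) : Matrix (Fin m × Fin n) (Fin m × Fin n) ℝ :=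
  Matrix.of fun p q => if p.1 = q.1 then 1 else 0

/-- A (0,1)-matrix. -/
def Is01 {α β : Type*} (A : Matrix α β ℝ) : Prop := ∀ i j, A i j = 0 ∨ A i j = 1

/-- `A` is a symmetric group divisible design with parameters `(m*n, k, m, n, l1, l2)`. -/
def IsSGDD {m n : ℕ} (A : Matrix (Fin m × Fin n) (Fin m × Fin n) ℝ)
    (k l1 l2 : ℕ) : Prop :=
  Is01 A ∧
  A * Aᵀ = (k : ℝ) • (1 : Matrix (Fin m × Fin n) (Fin m × Fin n) ℝ)
      + (l1 : ℝ) • (matK m n - 1) + (l2 : ℝ) • (matJ (Fin m × Fin n) - matK m n) ∧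
  Aᵀ * A = (k : ℝ) • (1 : Matrix (Fin m × Fin n) (Fin m × Fin n) ℝ)
      + (l1 : ℝ) • (matK m n - 1) + (l2 : ℝ) • (matJ (Fin m × Fin n) - matK m n)

/-- A linked system of symmetric group divisible designs of type II with parameters
`(m*n, k, m, n, l1, l2)` and `(σ, τ, ρ)`. -/
def IsLinkedSGDDII {f m n : ℕ}
    (A : Fin f → Fin f → Matrix (Fin m × Fin n) (Fin m × Fin n) ℝ)
    (k l1 l2 σ τ ρ : ℕ) : Prop :=
  (∀ i j, i ≠ j → (A i j)ᵀ = A j i) ∧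
  (∀ i j, i ≠ j → IsSGDD (A i j) k l1 l2) ∧
  (∀ i j, i ≠ j → Is01 (A i j + matK m n)) ∧
  (∀ i j l, i ≠ j → j ≠ l → i ≠ l →
    A i j * A j l = (σ : ℝ) • A i l
      + (τ : ℝ) • (matJ (Fin m × Fin n) - A i l - matK m n) + (ρ : ℝ) • matK m n)


/-- Row sums of a type II SGDD. -/
lemma aux_row {m n k l2 : ℕ} (A : Matrix (Fin m × Fin n) (Fin m × Fin n) ℝ)
    (h : IsSGDD A k 0 l2) (p : Fin m × Fin n) : ∑ q, A p q = k := by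
  obtain ⟨h01, h1, -⟩ := h
  have := congrFun (congrFun h1 p) p
  simp only [Matrix.mul_apply, Matrix.transpose_apply] at this
  have e : ∀ q, A p q * A p q = A p q := fun q => by
    rcases h01 p q with h | h <;> simp [h]
  simp only [e] at this
  rw [this]
  simp [matK, matJ]

lemma aux_le {m n k l2 : ℕ} (A : Matrix (Fin m × Fin n) (Fin m × Fin n) ℝ)
    (h : IsSGDD A k 0 l2) (p : Fin m × Fin n) (b : Fin m) : ∑ y, A p (b, y) ≤ 1 := by
  obtain ⟨h01, -, h2⟩ := h
  have hnn : ∀ p q, 0 ≤ A p q := fun p q => by rcases h01 p q with h | h <;> simp [h]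
  have hz : ∀ y y', y ≠ y' → A p (b, y) * A p (b, y') = 0 := by
    intro y y' hy
    have := congrFun (congrFun h2 (b, y)) (b, y')
    simp only [Matrix.mul_apply, Matrix.transpose_apply] at this
    have h0 : ∑ j, A j (b, y) * A j (b, y') = 0 := by
      rw [this]; simp [matK, matJ, Matrix.one_apply, hy]
    exact (Finset.sum_eq_zero_iff_of_nonneg
      (fun i _ => mul_nonneg (hnn _ _) (hnn _ _))).1 h0 p (Finset.mem_univ _)
  by_cases hex : ∃ y, A p (b, y) = 1
  · obtain ⟨y, hy⟩ := hex
    rw [Finset.sum_eq_single y]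
    · exact hy.le
    · intro y' _ hne
      have := hz y y' hne.symm
      rwa [hy, one_mul] at this
    · simp
  · push Not at hex
    rw [Finset.sum_eq_zero]
    · norm_num
    · intro y _
      exact (h01 p (b, y)).resolve_right (hex y)

lemma aux_diag {m n k l2 : ℕ} (A : Matrix (Fin m × Fin n) (Fin m × Fin n) ℝ)
    (h : IsSGDD A k 0 l2) (hK : Is01 (A + matK m n)) (p q : Fin m × Fin n)
    (hpq : p.1 = q.1) : A p q = 0 := by
  rcases h.1 p q with h0 | h0
  · exact h0
  · have := hK p q
    simp [matK, hpq, h0] at this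

lemma aux_block {m n k l2 : ℕ} (A : Matrix (Fin m × Fin n) (Fin m × Fin n) ℝ)
    (h : IsSGDD A k 0 l2) (hK : Is01 (A + matK m n)) (hm : m = k + 1)
    (p : Fin m × Fin n) (b : Fin m) (hb : b ≠ p.1) : ∑ y, A p (b, y) = 1 := by
  have hr := aux_row A h p
  rw [Fintype.sum_prod_type] at hr
  have hd : ∑ y, A p (p.1, y) = 0 :=
    Finset.sum_eq_zero fun y _ => aux_diag A h hK _ _ rfl
  have hs : ∑ c ∈ Finset.univ.erase p.1, (1 - ∑ y, A p (c, y)) = 0 := by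
    rw [Finset.sum_sub_distrib]
    have := Finset.add_sum_erase Finset.univ (fun c => ∑ y, A p (c, y)) (Finset.mem_univ p.1)
    simp only [hd, hr] at this
    rw [zero_add] at this
    rw [this]
    simp [hm]
  have := (Finset.sum_eq_zero_iff_of_nonneg
    (fun c _ => sub_nonneg.2 (aux_le A h p c))).1 hs b (by simp [hb])
  linarith

theorem stmt19 (g lam : ℕ) (hg : 2 ≤ g) (hlam : 1 ≤ lam) :
    ∀ f : ℕ, 3 ≤ f → ∀ σ τ ρ : ℕ,
    ∀ A : Fin f → Fin f →
      Matrix (Fin (g * lam + 2) × Fin g) (Fin (g * lam + 2) × Fin g) ℝ,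
    ¬ IsLinkedSGDDII A (g * lam + 1) 0 lam σ τ ρ := by
  rintro f hf σ τ ρ A ⟨-, hS, hK, hL⟩
  let a : Fin f := ⟨0, by omega⟩
  let b : Fin f := ⟨1, by omega⟩
  let c : Fin f := ⟨2, by omega⟩
  have hab : a ≠ b := by simp [a, b]
  have hbc : b ≠ c := by simp [b, c]
  have hac : a ≠ c := by simp [a, c]
  have hL := hL a b c hab hbc hac
  let p : Fin (g * lam + 2) × Fin g := (0, ⟨0, by omega⟩)
  have e1 : ∑ y, (A a b * A b c) p (p.1, y) = (g : ℝ) * ρ := by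
    rw [hL]
    have hd : ∀ y, A a c p (p.1, y) = 0 := fun y =>
      aux_diag _ (hS a c hac) (hK a c hac) _ _ rfl
    simp [hd, matJ, matK]
  have e2 : ∑ y, (A a b * A b c) p (p.1, y) = ((g * lam + 1 : ℕ) : ℝ) := by
    rw [← aux_row _ (hS a b hab) p]
    simp only [Matrix.mul_apply]
    rw [Finset.sum_comm]
    refine Finset.sum_congr rfl fun r _ => ?_
    rw [← Finset.mul_sum]
    by_cases hr : p.1 = r.1
    · rw [aux_diag _ (hS a b hab) (hK a b hab) p r hr, zero_mul]
    · rw [aux_block _ (hS b c hbc) (hK b c hbc) rfl r p.1 hr, mul_one]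
  rw [e1] at e2
  have e3 : g * ρ = g * lam + 1 := by exact_mod_cast e2
  have : g ∣ 1 := (Nat.dvd_add_right (Dvd.intro lam rfl)).1 (Dvd.intro ρ e3)
  have := Nat.le_of_dvd one_pos this
  omega
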